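/- arXiv:hep-th/9509094 — 2 statements merged into one kernel-verified Lean document; each statement's English description precedes it below -/
import Mathlib

section
/- Let δq(t,q₀,…,q_{2k−1}) be a smooth ℝⁿ-valued function, set δq_r = D_t^r δq (a function of (t,q₀,…,q_{2k−1+r})) for 0 ≤ r ≤ k, and define δL = Σ_{r=0}^{k} (∂L/∂q_r)·δq_r. Suppose there is a smooth function F(t,q₀,…,q_{3k−2}) with δL = D_t F identically (Noether's condition). Then the function G = Σ_{r=0}^{k−1} ⟨p̂^r, δq_r⟩ − F satisfies ⟨[L], δq⟩ + D_t G = 0 identically as functions of (t,q₀,…,q_{3k−1}); i.e., every Noether symmetry of a k-th order Lagrangian yields a conserved quantity G with [L]δq + D_t G = 0. -/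
open scoped BigOperators

noncomputable section

/-- `Vec n` is `ℝⁿ`. -/
abbrev Vec (n : ℕ) := Fin n → ℝ

/-- `Jet n m` packages the variables `q₀, …, q_m`, each a vector of `ℝⁿ`. -/
abbrev Jet (n m : ℕ) := Fin (m+1) → Vec n

/-- The standard inner product on `ℝⁿ`. -/
def dot {n : ℕ} (u v : Vec n) : ℝ := ∑ a, u a * v a

/-- Forget the top variable `q_{m+1}`. -/
def res {n m : ℕ} (q : Jet n (m+1)) : Jet n m := fun i => q i.castSucc

/-- The shift `(shft q) i = q (i+1)`. -/
def shft {n m : ℕ} (q : Jet n (m+1)) : Jet n m := fun i => q i.succ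

/-- Restriction of a jet to a lower-order jet. -/
def trunc {n m m' : ℕ} (h : m' ≤ m) (q : Jet n m) : Jet n m' :=
  fun i => q (Fin.castLE (Nat.succ_le_succ h) i)

/-- The partial gradient of `f` in the slot `q_i`, identified with a vector of `ℝⁿ`
via the standard inner product (i.e. the vector representing the partial
differential `∂f/∂q_i`). -/
def gradSlot {n m : ℕ} (f : Jet n m → ℝ) (q : Jet n m) (i : Fin (m+1)) : Vec n :=
  fun a => fderiv ℝ f q (Pi.single i (Pi.single a 1))

/-- The formal total time derivative of a time-independent function
`f(q₀,…,q_m)`: `D_t f = Σ_i (∂f/∂q_i)·q_{i+1}`, a function of `(q₀,…,q_{m+1})`. -/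
def Dt0 {n m : ℕ} {F : Type*} [NormedAddCommGroup F] [NormedSpace ℝ F]
    (f : Jet n m → F) (q : Jet n (m+1)) : F :=
  fderiv ℝ f (res q) (shft q)

/-- Iterated formal total time derivative (time-independent functions). -/
def DtIter0 {n m : ℕ} {F : Type*} [NormedAddCommGroup F] [NormedSpace ℝ F] :
    (r : ℕ) → (Jet n m → F) → (Jet n (m + r) → F)
  | 0, f => f
  | r+1, f => Dt0 (DtIter0 r f)

/-- The formal total time derivative of a time-dependent function
`f(t,q₀,…,q_m)`: `D_t f = ∂f/∂t + Σ_i (∂f/∂q_i)·q_{i+1}`. -/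
def Dt {n m : ℕ} {F : Type*} [NormedAddCommGroup F] [NormedSpace ℝ F]
    (f : ℝ × Jet n m → F) (x : ℝ × Jet n (m+1)) : F :=
  fderiv ℝ f (x.1, res x.2) (1, shft x.2)

/-- Iterated formal total time derivative (time-dependent functions). -/
def DtIter {n m : ℕ} {F : Type*} [NormedAddCommGroup F] [NormedSpace ℝ F] :
    (r : ℕ) → (ℝ × Jet n m → F) → (ℝ × Jet n (m + r) → F)
  | 0, f => f
  | r+1, f => Dt (DtIter r f)

/-- The partial gradient in the slot `q_i` of a time-dependent function. -/
def gradSlotT {n m : ℕ} (f : ℝ × Jet n m → ℝ) (x : ℝ × Jet n m) (i : Fin (m+1)) : Vec n :=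
  fun a => fderiv ℝ f x (0, Pi.single i (Pi.single a 1))

/-- The Ostrogradskii momenta of a Lagrangian `L(q₀,…,q_{k+1})` of order `k+1`:
`mom L j` is the momentum `p̂^{k-j}`, a function of `(q₀,…,q_{k+j+1})`.
It is defined by the downward recursion `p̂^{k} = ∂L/∂q_{k+1}` and
`p̂^{i-1} = ∂L/∂q_i − D_t p̂^i`. -/
def mom {n k : ℕ} (L : Jet n (k+1) → ℝ) : (j : ℕ) → (Jet n (k + j + 1) → Vec n)
  | 0 => fun q => gradSlot L q (Fin.last (k+1))
  | j+1 => fun q =>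
      gradSlot L (trunc (by omega) q) ⟨k - j, by omega⟩ - Dt0 (mom L j) q

/-- The Euler–Lagrange expression `[L] = Σ_{r=0}^{k+1} (−1)^r D_t^r (∂L/∂q_r)`
of a Lagrangian of order `k+1`, a function of `(q₀,…,q_{2(k+1)})`. -/
def EL {n k : ℕ} (L : Jet n (k+1) → ℝ) (q : Jet n (k+k+2)) : Vec n :=
  ∑ r : Fin (k+2),
    ((-1 : ℝ)) ^ (r : ℕ) •
      DtIter0 (r : ℕ) (fun q' => gradSlot L q' r)
        (trunc (by have := r.isLt; omega) q)

/-- The Hessian `W = ∂²L/∂q_{k+1}∂q_{k+1}` of a Lagrangian of order `k+1`,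
as an operator `ℝⁿ → ℝⁿ` (a function of `(q₀,…,q_{k+1})`). -/
def hessOp {n k : ℕ} (L : Jet n (k+1) → ℝ) (q : Jet n (k+1)) (v : Vec n) : Vec n :=
  fun a => fderiv ℝ (fun q' => gradSlot L q' (Fin.last (k+1)) a) q
    (Pi.single (Fin.last (k+1)) v)

/-- The first partial Legendre–Ostrogradskii transformation
`F₀ : (q₀,…,q_{2k+1}) ↦ (q₀,…,q_{2k}; p̂⁰)`. -/
def F0 {n k : ℕ} (L : Jet n (k+1) → ℝ) (q : Jet n (k+k+1)) : Jet n (k+k) × Vec n :=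
  (res q, mom L k q)

/-- Pull-back through `F₀` of a (time-dependent) function on the intermediate
space `P₁`. -/
def pullF0 {n k : ℕ} {F : Type*} (L : Jet n (k+1) → ℝ)
    (g : ℝ × (Jet n (k+k) × Vec n) → F) (x : ℝ × Jet n (k+k+1)) : F :=
  g (x.1, F0 L x.2)

/-- The intermediate evolution operator `K₀`:
`K₀·g = (∂g/∂t)∘F₀ + Σ_{i=0}^{2k} ((∂g/∂q_i)∘F₀)·q_{i+1} + ((∂g/∂p⁰)∘F₀)·(∂L/∂q₀)`. -/
def K0 {n k : ℕ} {F : Type*} [NormedAddCommGroup F] [NormedSpace ℝ F]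
    (L : Jet n (k+1) → ℝ)
    (g : ℝ × (Jet n (k+k) × Vec n) → F) (x : ℝ × Jet n (k+k+1)) : F :=
  fderiv ℝ g (x.1, F0 L x.2)
    (1, shft x.2, gradSlot L (trunc (by omega) x.2) 0)

/-- The partial gradient `∂g/∂p⁰` of a function on `P₁`, as a vector of `ℝⁿ`. -/
def gradMom {n k : ℕ} (g : ℝ × (Jet n (k+k) × Vec n) → ℝ)
    (x : ℝ × (Jet n (k+k) × Vec n)) : Vec n :=
  fun a => fderiv ℝ g x (0, 0, Pi.single a 1)

/-- The `m`-jet at time `s` of a curve whose successive derivatives are `c 0, c 1, …`. -/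
def curveJet {n : ℕ} (c : ℕ → ℝ → Vec n) (m : ℕ) (s : ℝ) : Jet n m := fun i => c i s

/-- The gradient of `L` in the slot `q_r`, extended by zero to all natural numbers `r`. -/
def slotGrad {n m : ℕ} (L : Jet n m → ℝ) (r : ℕ) (q : Jet n m) : Vec n :=
  if h : r < m + 1 then gradSlot L q ⟨r, h⟩ else 0

section Smoothness

variable {n m : ℕ} {E : Type*} [NormedAddCommGroup E] [NormedSpace ℝ E]

lemma contDiff_res : ContDiff ℝ (⊤ : ℕ∞) (res : Jet n (m+1) → Jet n m) := by
  unfold res; fun_prop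

lemma contDiff_shft : ContDiff ℝ (⊤ : ℕ∞) (shft : Jet n (m+1) → Jet n m) := by
  unfold shft; fun_prop

lemma contDiff_trunc {m' : ℕ} (h : m' ≤ m) :
    ContDiff ℝ (⊤ : ℕ∞) (trunc h : Jet n m → Jet n m') := by
  unfold trunc; fun_prop

lemma contDiff_dot {X : Type*} [NormedAddCommGroup X] [NormedSpace ℝ X] {u v : X → Vec n}
    (hu : ContDiff ℝ (⊤ : ℕ∞) u) (hv : ContDiff ℝ (⊤ : ℕ∞) v) :
    ContDiff ℝ (⊤ : ℕ∞) (fun x => dot (u x) (v x)) := by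
  unfold dot; fun_prop

lemma contDiff_gradSlot {f : Jet n m → ℝ} (hf : ContDiff ℝ (⊤ : ℕ∞) f) (i : Fin (m+1)) :
    ContDiff ℝ (⊤ : ℕ∞) (fun q => gradSlot f q i) :=
  contDiff_pi.2 fun _ => (hf.fderiv_right (m := (⊤ : ℕ∞)) (by simp)).clm_apply contDiff_const

lemma contDiff_slotGrad {f : Jet n m → ℝ} (hf : ContDiff ℝ (⊤ : ℕ∞) f) (r : ℕ) :
    ContDiff ℝ (⊤ : ℕ∞) (slotGrad f r) := by
  unfold slotGrad
  split_ifs with h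
  · exact contDiff_gradSlot hf ⟨r, h⟩
  · exact contDiff_const

lemma contDiff_Dt0 {f : Jet n m → E} (hf : ContDiff ℝ (⊤ : ℕ∞) f) :
    ContDiff ℝ (⊤ : ℕ∞) (Dt0 f) :=
  ((hf.fderiv_right (m := (⊤ : ℕ∞)) (by simp)).comp contDiff_res).clm_apply contDiff_shft

lemma contDiff_DtIter0 {f : Jet n m → E} (hf : ContDiff ℝ (⊤ : ℕ∞) f) :
    ∀ r, ContDiff ℝ (⊤ : ℕ∞) (DtIter0 r f)
  | 0 => hf
  | r+1 => contDiff_Dt0 (contDiff_DtIter0 hf r)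

lemma contDiff_Dt {f : ℝ × Jet n m → E} (hf : ContDiff ℝ (⊤ : ℕ∞) f) :
    ContDiff ℝ (⊤ : ℕ∞) (Dt f) :=
  ((hf.fderiv_right (m := (⊤ : ℕ∞)) (by simp)).comp
    (contDiff_fst.prodMk (contDiff_res.comp contDiff_snd))).clm_apply
    (contDiff_const.prodMk (contDiff_shft.comp contDiff_snd))

lemma contDiff_DtIter {f : ℝ × Jet n m → E} (hf : ContDiff ℝ (⊤ : ℕ∞) f) :
    ∀ r, ContDiff ℝ (⊤ : ℕ∞) (DtIter r f)
  | 0 => hf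
  | r+1 => contDiff_Dt (contDiff_DtIter hf r)

lemma contDiff_mom {k : ℕ} {L : Jet n (k+1) → ℝ} (hL : ContDiff ℝ (⊤ : ℕ∞) L) :
    ∀ j, ContDiff ℝ (⊤ : ℕ∞) (mom L j)
  | 0 => contDiff_gradSlot hL _
  | j+1 => ((contDiff_gradSlot hL _).comp (contDiff_trunc _)).sub
      (contDiff_Dt0 (contDiff_mom hL j))

end Smoothness

section AlongCurves

variable {n m : ℕ} {E : Type*} [NormedAddCommGroup E] [NormedSpace ℝ E]

/-- Every jet is the jet at time `t` of a curve. -/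
lemma exists_curve_of_jet (t : ℝ) (q : Jet n m) :
    ∃ c : ℕ → ℝ → Vec n, (∀ i s, HasDerivAt (c i) (c (i+1) s) s) ∧ curveJet c m t = q := by
  set Q : ℕ → Vec n := fun i => if h : i < m + 1 then q ⟨i, h⟩ else 0 with hQ
  refine ⟨fun i s => ∑ j ∈ Finset.range (m+1), ((s - t) ^ j / (j.factorial : ℝ)) • Q (i + j),
    fun i s => ?_, ?_⟩
  · have key : HasDerivAt
        (fun s => ∑ j ∈ Finset.range (m+1), ((s - t) ^ j / (j.factorial : ℝ)) • Q (i + j))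
        (∑ j ∈ Finset.range (m+1),
          (((j : ℝ) * (s - t) ^ (j - 1) * 1) / (j.factorial : ℝ)) • Q (i + j)) s :=
      HasDerivAt.fun_sum fun j _ =>
        ((((hasDerivAt_id s).sub_const t).pow j).div_const _).smul_const _
    convert key using 1
    have htop : Q (i + 1 + m) = 0 := by simp [hQ]
    rw [Finset.sum_range_succ']
    beta_reduce
    rw [Finset.sum_range_succ, htop]
    simp only [smul_zero, add_zero, Nat.cast_zero, zero_mul, zero_div, zero_smul]
    refine Finset.sum_congr rfl fun j _ => ?_
    have h1 : i + 1 + j = i + (j + 1) := by omega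
    have h2 : ((j : ℝ) + 1) ≠ 0 := by positivity
    have h3 : (j.factorial : ℝ) ≠ 0 := by positivity
    rw [h1, Nat.factorial_succ, Nat.add_sub_cancel]
    congr 1
    push_cast
    field_simp
  · funext i
    simp only [curveJet, sub_self]
    rw [Finset.sum_range_succ']
    have hi : (i : ℕ) < m + 1 := i.isLt
    simp [hQ, hi, -Order.lt_add_one_iff]

variable {c : ℕ → ℝ → Vec n}

lemma hasDerivAt_curveJet (hc : ∀ i s, HasDerivAt (c i) (c (i+1) s) s) (s : ℝ) :
    HasDerivAt (curveJet c m) (shft (curveJet c (m+1) s)) s :=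
  hasDerivAt_pi.2 fun i => hc i s

lemma hasDerivAt_comp_curveJet (hc : ∀ i s, HasDerivAt (c i) (c (i+1) s) s)
    {f : Jet n m → E} (hf : ContDiff ℝ (⊤ : ℕ∞) f) (s : ℝ) :
    HasDerivAt (fun s => f (curveJet c m s)) (Dt0 f (curveJet c (m+1) s)) s :=
  ((hf.differentiable (by simp)) (curveJet c m s)).hasFDerivAt.comp_hasDerivAt s
    (hasDerivAt_curveJet hc s)

lemma hasDerivAt_comp_time_curveJet (hc : ∀ i s, HasDerivAt (c i) (c (i+1) s) s)
    {f : ℝ × Jet n m → E} (hf : ContDiff ℝ (⊤ : ℕ∞) f) (s : ℝ) :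
    HasDerivAt (fun s => f (s, curveJet c m s)) (Dt f (s, curveJet c (m+1) s)) s :=
  ((hf.differentiable (by simp)) (s, curveJet c m s)).hasFDerivAt.comp_hasDerivAt s
    ((hasDerivAt_id s).prodMk (hasDerivAt_curveJet hc s))

lemma hasDerivAt_dot {u v : ℝ → Vec n} {u' v' : Vec n} {s : ℝ}
    (hu : HasDerivAt u u' s) (hv : HasDerivAt v v' s) :
    HasDerivAt (fun s => dot (u s) (v s)) (dot u' (v s) + dot (u s) v') s := by
  unfold dot
  rw [← Finset.sum_add_distrib]
  exact HasDerivAt.fun_sum fun a _ => (hasDerivAt_pi.1 hu a).mul (hasDerivAt_pi.1 hv a)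

lemma dot_sub_left (u v w : Vec n) : dot (u - v) w = dot u w - dot v w := by
  simp [dot, sub_mul, Finset.sum_sub_distrib]

variable {k : ℕ} {L : Jet n (k+1) → ℝ}

lemma mom_succ_curveJet {j : ℕ} (s : ℝ) :
    mom L (j+1) (curveJet c (k + (j+1) + 1) s) =
      slotGrad L (k - j) (curveJet c (k+1) s) - Dt0 (mom L j) (curveJet c (k + j + 1 + 1) s) := by
  have h : k - j < k + 1 + 1 := by omega
  rw [slotGrad, dif_pos h]
  rfl

lemma Dt0_mom_curveJet (hc : ∀ i s, HasDerivAt (c i) (c (i+1) s) s)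
    (hL : ContDiff ℝ (⊤ : ℕ∞) L) {j : ℕ}
    (hmom : ∀ s, mom L j (curveJet c (k + j + 1) s) = ∑ i ∈ Finset.range (j+1),
      (-1 : ℝ) ^ i • DtIter0 i (slotGrad L (k + 1 - j + i)) (curveJet c (k + 1 + i) s)) (s : ℝ) :
    Dt0 (mom L j) (curveJet c (k + j + 1 + 1) s) = ∑ i ∈ Finset.range (j+1),
      (-1 : ℝ) ^ i •
        DtIter0 (i+1) (slotGrad L (k + 1 - j + i)) (curveJet c (k + 1 + (i + 1)) s) := by
  have hd := hasDerivAt_comp_curveJet hc (contDiff_mom hL j) s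
  rw [funext hmom] at hd
  exact hd.unique (HasDerivAt.fun_sum fun i _ => HasDerivAt.fun_const_smul ((-1 : ℝ) ^ i)
    (hasDerivAt_comp_curveJet hc
      (contDiff_DtIter0 (contDiff_slotGrad hL (k + 1 - j + i)) i) s))

/-- The momenta along a curve, as alternating sums of total derivatives of the gradients. -/
lemma mom_curveJet (hc : ∀ i s, HasDerivAt (c i) (c (i+1) s) s)
    (hL : ContDiff ℝ (⊤ : ℕ∞) L) {j : ℕ} (hj : j ≤ k) (s : ℝ) :
    mom L j (curveJet c (k + j + 1) s) = ∑ i ∈ Finset.range (j+1),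
      (-1 : ℝ) ^ i • DtIter0 i (slotGrad L (k + 1 - j + i)) (curveJet c (k + 1 + i) s) := by
  induction j generalizing s with
  | zero =>
    have h : k + 1 < k + 1 + 1 := by omega
    simp only [zero_add, Finset.sum_range_one, pow_zero, one_smul, DtIter0]
    rw [show k + 1 - 0 + 0 = k + 1 by omega, slotGrad, dif_pos h]
    rfl
  | succ j ih =>
    rw [mom_succ_curveJet, Dt0_mom_curveJet hc hL (ih (by omega)), Finset.sum_range_succ' _ (j+1), sub_eq_add_neg,
      add_comm, ← Finset.sum_neg_distrib]
    congr 1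
    · refine Finset.sum_congr rfl fun i _ => ?_
      rw [show k + 1 - (j + 1) + (i + 1) = k + 1 - j + i by omega, pow_succ, mul_neg_one, neg_smul]
    · rw [show k + 1 - (j + 1) + 0 = k - j by omega, pow_zero, one_smul]
      rfl

/-- The Euler–Lagrange expression continues the recursion of the momenta. -/
lemma EL_curveJet (hc : ∀ i s, HasDerivAt (c i) (c (i+1) s) s)
    (hL : ContDiff ℝ (⊤ : ℕ∞) L) (s : ℝ) :
    EL L (curveJet c (k + k + 2) s) =
      slotGrad L 0 (curveJet c (k+1) s) - Dt0 (mom L k) (curveJet c (k + k + 1 + 1) s) := by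
  have hEL : EL L (curveJet c (k + k + 2) s) = ∑ r ∈ Finset.range (k+2),
      (-1 : ℝ) ^ r • DtIter0 r (slotGrad L r) (curveJet c (k + 1 + r) s) := by
    rw [Finset.sum_range, EL]
    refine Finset.sum_congr rfl fun r _ => ?_
    have hr : slotGrad L (r : ℕ) = fun q' => gradSlot L q' r := by
      funext q'
      rw [slotGrad, dif_pos r.isLt]
    rw [hr]
    rfl
  rw [hEL, Dt0_mom_curveJet hc hL (mom_curveJet hc hL le_rfl), Finset.sum_range_succ', sub_eq_add_neg, add_comm,
    ← Finset.sum_neg_distrib]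
  congr 1
  · rw [pow_zero, one_smul]
    rfl
  · refine Finset.sum_congr rfl fun i _ => ?_
    rw [show k + 1 - k + i = i + 1 by omega, pow_succ, mul_neg_one, neg_smul]

end AlongCurves

/-- Noether's symmetry yields a conserved quantity.
Let `δq(t,q₀,…,q_{2k+1})` be an infinitesimal transformation, `δq_r = D_t^r δq`,
and `δL = Σ_{r=0}^{k+1} (∂L/∂q_r)·δq_r`.  If `δL = D_t F` identically
(Noether's condition), then `G = Σ_{r=0}^{k} ⟨p̂^r, δq_r⟩ − F` satisfies
`⟨[L],δq⟩ + D_t G = 0` identically. -/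
theorem noether_symmetry_conserved_quantity
    (n k : ℕ) (hn : 1 ≤ n)
    (L : Jet n (k+1) → ℝ) (hL : ContDiff ℝ (⊤ : ℕ∞) L)
    (δq : ℝ × Jet n (k+k+1) → Vec n) (hδq : ContDiff ℝ (⊤ : ℕ∞) δq)
    (F : ℝ × Jet n (k+k+1+k) → ℝ) (hF : ContDiff ℝ (⊤ : ℕ∞) F)
    (hNoether : ∀ (t : ℝ) (q : Jet n (k+k+1+(k+1))),
      (∑ r : Fin (k+2),
        dot (gradSlot L (trunc (by omega) q) r)
            (DtIter (r : ℕ) δq (t, trunc (by have := r.isLt; omega) q)))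
        = Dt F (t, q)) :
    ∀ (t : ℝ) (q : Jet n (k+k+1+(k+1))),
      dot (EL L (trunc (by omega) q)) (δq (t, trunc (by omega) q)) +
        Dt (fun x : ℝ × Jet n (k+k+1+k) =>
          (∑ r : Fin (k+1),
            dot (mom L (k - (r : ℕ)) (trunc (by have := r.isLt; omega) x.2))
                (DtIter (r : ℕ) δq (x.1, trunc (by have := r.isLt; omega) x.2)))
          - F x) (t, q) = 0 := by
  intro t q
  obtain ⟨c, hc, rfl⟩ := exists_curve_of_jet t q
  set l : ℕ → Vec n := fun r => slotGrad L r (curveJet c (k+1) t) with hl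
  set P : ℕ → Vec n := fun r => DtIter r δq (t, curveJet c (k+k+1+r) t) with hP
  set A : ℕ → Vec n := fun r => Nat.casesOn r (EL L (curveJet c (k+k+2) t))
    (fun r => mom L (k - r) (curveJet c (k + (k - r) + 1) t)) with hA
  have hmom : ∀ r < k + 1, Dt0 (mom L (k - r)) (curveJet c (k + (k - r) + 1 + 1) t) =
      l r - A r := by
    rintro (_ | r) hr
    · simp only [hl, hA]
      rw [EL_curveJet hc hL]
      exact (sub_sub_cancel _ _).symm
    · have hj : k - r = k - (r + 1) + 1 := by omega
      simp only [hl, hA]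
      rw [hj, mom_succ_curveJet, show k - (k - (r + 1)) = r + 1 by omega]
      exact (sub_sub_cancel _ _).symm
  have hG : ContDiff ℝ (⊤ : ℕ∞) (fun x : ℝ × Jet n (k+k+1+k) =>
      (∑ r : Fin (k+1),
        dot (mom L (k - (r : ℕ)) (trunc (by have := r.isLt; omega) x.2))
            (DtIter (r : ℕ) δq (x.1, trunc (by have := r.isLt; omega) x.2))) - F x) :=
    (ContDiff.sum fun r _ => contDiff_dot
      ((contDiff_mom hL _).comp ((contDiff_trunc _).comp contDiff_snd))
      ((contDiff_DtIter hδq _).comp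
        (contDiff_fst.prodMk ((contDiff_trunc _).comp contDiff_snd)))).sub hF
  have hd : HasDerivAt (fun s => (∑ r : Fin (k+1),
        dot (mom L (k - (r : ℕ)) (curveJet c (k + (k - (r : ℕ)) + 1) s))
            (DtIter (r : ℕ) δq (s, curveJet c (k+k+1+r) s))) - F (s, curveJet c (k+k+1+k) s))
      ((∑ r : Fin (k+1), (dot (l r - A r) (P r) + dot (A (r + 1)) (P (r + 1)))) -
        Dt F (t, curveJet c (k+k+1+k+1) t)) t := by
    refine (HasDerivAt.fun_sum fun r _ => ?_).sub (hasDerivAt_comp_time_curveJet hc hF t)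
    rw [← hmom r r.isLt]
    exact hasDerivAt_dot (hasDerivAt_comp_curveJet hc (contDiff_mom hL _) t)
      (hasDerivAt_comp_time_curveJet hc (contDiff_DtIter hδq _) t)
  have hDt := (hasDerivAt_comp_time_curveJet hc hG t).unique hd
  have hN : ∑ r ∈ Finset.range (k+2), dot (l r) (P r) = Dt F (t, curveJet c (k+k+1+k+1) t) := by
    rw [Finset.sum_range]
    refine Eq.trans (Finset.sum_congr rfl fun r _ => ?_) (hNoether t (curveJet c _ t))
    simp only [hl]
    rw [slotGrad, dif_pos r.isLt]
    rfl
  have hlast : A (k + 1) = l (k + 1) := by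
    have h : k + 1 < k + 1 + 1 := by omega
    simp only [hl, hA]
    rw [Nat.sub_self, slotGrad, dif_pos h]
    rfl
  have htel : ∑ r ∈ Finset.range (k+1), (dot (l r - A r) (P r) + dot (A (r + 1)) (P (r + 1))) =
      ∑ r ∈ Finset.range (k+2), dot (l r) (P r) - dot (A 0) (P 0) := by
    have := Finset.sum_range_sub (fun r => dot (A r) (P r)) (k+1)
    rw [Finset.sum_range_succ _ (k+1), ← hlast, add_sub_assoc, ← this, ← Finset.sum_add_distrib]
    refine Finset.sum_congr rfl fun r _ => ?_
    rw [dot_sub_left]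
    ring
  rw [Finset.sum_range, hN] at htel
  rw [htel] at hDt
  refine (congrArg (dot (A 0) (P 0) + ·) hDt).trans ?_
  ring

end
end

section
/- For the curvature Lagrangian L(x₀,x₁,x₂) = α√δ₂/δ₁, the Ostrogradskii momenta satisfy, identically on the set where δ₁ > 0 and δ₂ > 0: (p̂¹ x₁) = 0, (p̂¹ p̂¹) = α²/(x₁ x₁), (p̂⁰ x₁) = 0, (p̂⁰ p̂¹) = 0, and (p̂⁰ p̂⁰) = α² δ₃/δ₂² (so the image of the total Legendre–Ostrogradskii transformation lies in the zero set of the Hamiltonian constraints of the model). -/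
open scoped BigOperators Matrix

noncomputable section

/-- `V d` is `ℝ^d`. -/
abbrev V (d : ℕ) := Fin d → ℝ

variable {d : ℕ}

/-- The bilinear form determined by the symmetric matrix `B`:
`(u v) = B(u,v) = uᵀ B v`. -/
def bf (B : Matrix (Fin d) (Fin d) ℝ) (u v : V d) : ℝ := u ⬝ᵥ B *ᵥ v

/-- The Gram determinant of a family of vectors with respect to `B`. -/
def gram (B : Matrix (Fin d) (Fin d) ℝ) {m : ℕ} (x : Fin m → V d) : ℝ :=
  (Matrix.of fun i j => bf B (x i) (x j)).det

/-- `δ₁ = (x₁ x₁)` as a `1×1` Gram determinant. -/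
def d1 (B : Matrix (Fin d) (Fin d) ℝ) (x1 : V d) : ℝ := gram B ![x1]

/-- `δ₂`, the Gram determinant of `x₁, x₂`. -/
def d2 (B : Matrix (Fin d) (Fin d) ℝ) (x1 x2 : V d) : ℝ := gram B ![x1, x2]

/-- `δ₃`, the Gram determinant of `x₁, x₂, x₃`. -/
def d3 (B : Matrix (Fin d) (Fin d) ℝ) (x1 x2 x3 : V d) : ℝ := gram B ![x1, x2, x3]

/-- The orthogonalized vector `ξ₂ = x₂ − ((x₂ ξ₁)/(ξ₁ ξ₁)) ξ₁` (with `ξ₁ = x₁`). -/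
def xi2 (B : Matrix (Fin d) (Fin d) ℝ) (x1 x2 : V d) : V d :=
  x2 - (bf B x2 x1 / bf B x1 x1) • x1

/-- The orthogonalized vector
`ξ₃ = x₃ − ((x₃ ξ₂)/(ξ₂ ξ₂)) ξ₂ − ((x₃ ξ₁)/(ξ₁ ξ₁)) ξ₁`. -/
def xi3 (B : Matrix (Fin d) (Fin d) ℝ) (x1 x2 x3 : V d) : V d :=
  x3 - (bf B x3 (xi2 B x1 x2) / bf B (xi2 B x1 x2) (xi2 B x1 x2)) • xi2 B x1 x2
     - (bf B x3 x1 / bf B x1 x1) • x1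

/-- The curvature Lagrangian `L(x₀,x₁,x₂) = α √δ₂ / δ₁` of the relativistic
particle (independent of `x₀`). -/
def Lc (B : Matrix (Fin d) (Fin d) ℝ) (α : ℝ) (x : V d × V d × V d) : ℝ :=
  α * Real.sqrt (d2 B x.2.1 x.2.2) / d1 B x.2.1

/-- The Ostrogradskii momentum `p̂¹`, identified with a vector via `B`:
the (for nondegenerate symmetric `B`, unique) vector with
`B(p̂¹,v) = (∂L/∂x₂)[v]` for all `v`. -/
def p1h (B : Matrix (Fin d) (Fin d) ℝ) (α : ℝ) (x0 x1 x2 : V d) : V d :=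
  B⁻¹ *ᵥ fun a => fderiv ℝ (Lc B α) (x0, x1, x2) (0, 0, Pi.single a 1)

/-- The Ostrogradskii momentum `p̂⁰`, identified with a vector via `B`:
the vector with `B(p̂⁰,v) = (∂L/∂x₁)[v] − (D_t B(p̂¹,·))[v]` for all `v`. -/
def p0h (B : Matrix (Fin d) (Fin d) ℝ) (α : ℝ) (x0 x1 x2 x3 : V d) : V d :=
  B⁻¹ *ᵥ fun a =>
    fderiv ℝ (Lc B α) (x0, x1, x2) (0, Pi.single a 1, 0) -
      fderiv ℝ (fun y : V d × V d × V d =>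
          bf B (p1h B α y.1 y.2.1 y.2.2) (Pi.single a 1))
        (x0, x1, x2) (x1, x2, x3)

/-- The Euler–Lagrange expression `[L] = ∂L/∂x₀ − D_t(B(p̂⁰,·))` as a covector,
evaluated on the vector `v`. -/
def ELc (B : Matrix (Fin d) (Fin d) ℝ) (α : ℝ) (x0 x1 x2 x3 x4 : V d) (v : V d) : ℝ :=
  fderiv ℝ (Lc B α) (x0, x1, x2) (v, 0, 0) -
    fderiv ℝ (fun y : V d × V d × V d × V d =>
        bf B (p0h B α y.1 y.2.1 y.2.2.1 y.2.2.2) v)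
      (x0, x1, x2, x3) (x1, x2, x3, x4)

/-- The formal total time derivative of a time-dependent function
`f(t,x₀,x₁,x₂,x₃)`, a function of `(t,x₀,…,x₄)`. -/
def DtT (f : ℝ × (V d × V d × V d × V d) → ℝ)
    (t : ℝ) (x0 x1 x2 x3 x4 : V d) : ℝ :=
  fderiv ℝ f (t, (x0, x1, x2, x3)) (1, (x1, x2, x3, x4))
lemma d1_eq (B : Matrix (Fin d) (Fin d) ℝ) (x1 : V d) : d1 B x1 = bf B x1 x1 := by
  simp [d1, gram]

lemma d2_eq (B : Matrix (Fin d) (Fin d) ℝ) (x1 x2 : V d) :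
    d2 B x1 x2 = bf B x1 x1 * bf B x2 x2 - bf B x1 x2 * bf B x2 x1 := by
  simp [d2, gram, Matrix.det_fin_two]

lemma d3_eq (B : Matrix (Fin d) (Fin d) ℝ) (x1 x2 x3 : V d) :
    d3 B x1 x2 x3 =
      bf B x1 x1 * bf B x2 x2 * bf B x3 x3 - bf B x1 x1 * bf B x2 x3 * bf B x3 x2
        - bf B x1 x2 * bf B x2 x1 * bf B x3 x3 + bf B x1 x2 * bf B x2 x3 * bf B x3 x1
        + bf B x1 x3 * bf B x2 x1 * bf B x3 x2 - bf B x1 x3 * bf B x2 x2 * bf B x3 x1 := by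
  simp [d3, gram, Matrix.det_fin_three]

lemma bf_add_left (B : Matrix (Fin d) (Fin d) ℝ) (u v w : V d) :
    bf B (u + v) w = bf B u w + bf B v w := by simp [bf, add_dotProduct]

lemma bf_sub_left (B : Matrix (Fin d) (Fin d) ℝ) (u v w : V d) :
    bf B (u - v) w = bf B u w - bf B v w := by simp [bf, sub_dotProduct]

lemma bf_smul_left (B : Matrix (Fin d) (Fin d) ℝ) (c : ℝ) (u w : V d) :
    bf B (c • u) w = c * bf B u w := by simp [bf]

lemma bf_add_right (B : Matrix (Fin d) (Fin d) ℝ) (u v w : V d) :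
    bf B u (v + w) = bf B u v + bf B u w := by simp [bf, Matrix.mulVec_add]

lemma bf_sub_right (B : Matrix (Fin d) (Fin d) ℝ) (u v w : V d) :
    bf B u (v - w) = bf B u v - bf B u w := by simp [bf, Matrix.mulVec_sub]

lemma bf_smul_right (B : Matrix (Fin d) (Fin d) ℝ) (c : ℝ) (u w : V d) :
    bf B u (c • w) = c * bf B u w := by simp [bf, Matrix.mulVec_smul]

lemma bf_comm {B : Matrix (Fin d) (Fin d) ℝ} (hB : B.IsSymm) (u v : V d) :
    bf B u v = bf B v u := by
  unfold bf
  rw [Matrix.dotProduct_mulVec, dotProduct_comm, ← Matrix.mulVec_transpose, hB.eq]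

lemma differentiable_bf (B : Matrix (Fin d) (Fin d) ℝ) :
    Differentiable ℝ fun p : V d × V d => bf B p.1 p.2 := by
  simp only [bf, dotProduct, Matrix.mulVec]
  fun_prop

lemma DifferentiableAt.bf {E : Type*} [NormedAddCommGroup E] [NormedSpace ℝ E]
    {B : Matrix (Fin d) (Fin d) ℝ} {f g : E → V d} {x : E}
    (hf : DifferentiableAt ℝ f x) (hg : DifferentiableAt ℝ g x) :
    DifferentiableAt ℝ (fun y => bf B (f y) (g y)) x :=
  (differentiable_bf B _).comp x (hf.prodMk hg)

lemma HasDerivAt.bf {B : Matrix (Fin d) (Fin d) ℝ} {f g : ℝ → V d} {f' g' : V d} {t : ℝ}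
    (hf : HasDerivAt f f' t) (hg : HasDerivAt g g' t) :
    HasDerivAt (fun s => bf B (f s) (g s)) (bf B f' (g t) + bf B (f t) g') t := by
  rw [hasDerivAt_pi] at hf hg
  have h : ∀ i ∈ Finset.univ, HasDerivAt
      (fun s => f s i * ∑ j, B i j * g s j)
      (f' i * (∑ j, B i j * g t j) + f t i * ∑ j, B i j * g' j) t := fun i _ =>
    (hf i).mul (HasDerivAt.fun_sum fun j _ => (hg j).const_mul (B i j))
  have := HasDerivAt.fun_sum h
  rw [Finset.sum_add_distrib] at this
  exact this

/-- A directional derivative equals the derivative along an affine line. -/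
lemma fderiv_apply_eq_of_hasDerivAt {E : Type*} [NormedAddCommGroup E] [NormedSpace ℝ E]
    {f : E → ℝ} {x v : E} {c : ℝ} (hf : DifferentiableAt ℝ f x)
    (h : HasDerivAt (fun t : ℝ => f (x + t • v)) c 0) : fderiv ℝ f x v = c :=
  (hf.hasFDerivAt.hasLineDerivAt v).unique h

lemma hasDerivAt_line (x v : V d) : HasDerivAt (fun t : ℝ => x + t • v) v 0 := by
  simpa using ((hasDerivAt_id (0 : ℝ)).smul_const v).const_add x

lemma differentiableAt_d2 (B : Matrix (Fin d) (Fin d) ℝ) (y : V d × V d × V d) :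
    DifferentiableAt ℝ (fun y : V d × V d × V d => d2 B y.2.1 y.2.2) y := by
  simp only [d2_eq]
  have h1 : DifferentiableAt ℝ (fun y : V d × V d × V d => y.2.1) y := by fun_prop
  have h2 : DifferentiableAt ℝ (fun y : V d × V d × V d => y.2.2) y := by fun_prop
  exact ((h1.bf h1).mul (h2.bf h2)).sub ((h1.bf h2).mul (h2.bf h1))

lemma differentiableAt_d1 (B : Matrix (Fin d) (Fin d) ℝ) (y : V d × V d × V d) :
    DifferentiableAt ℝ (fun y : V d × V d × V d => d1 B y.2.1) y := by
  simp only [d1_eq]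
  have h1 : DifferentiableAt ℝ (fun y : V d × V d × V d => y.2.1) y := by fun_prop
  exact h1.bf h1

/-- The Gram determinant `δ₂` along a line. -/
lemma hasDerivAt_d2_line {B : Matrix (Fin d) (Fin d) ℝ} (hB : B.IsSymm) (x1 x2 v1 v2 : V d) :
    HasDerivAt (fun t : ℝ => d2 B (x1 + t • v1) (x2 + t • v2))
      (2 * (bf B x1 v1 * bf B x2 x2 + bf B x1 x1 * bf B x2 v2
        - bf B x1 x2 * (bf B x2 v1 + bf B x1 v2))) 0 := by
  simp only [d2_eq]
  have h1 := hasDerivAt_line x1 v1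
  have h2 := hasDerivAt_line x2 v2
  refine (((h1.bf (B := B) h1).fun_mul (h2.bf h2)).fun_sub
    ((h1.bf h2).fun_mul (h2.bf h1))).congr_deriv ?_
  simp only [zero_smul, add_zero]
  rw [bf_comm hB v1 x1, bf_comm hB v2 x2, bf_comm hB v1 x2, bf_comm hB v2 x1, bf_comm hB x2 x1]
  ring

lemma differentiableAt_Lc {B : Matrix (Fin d) (Fin d) ℝ} (α : ℝ) {x0 x1 x2 : V d}
    (h1 : 0 < d1 B x1) (h2 : 0 < d2 B x1 x2) : DifferentiableAt ℝ (Lc B α) (x0, x1, x2) := by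
  have e2 : DifferentiableAt ℝ (fun y : V d × V d × V d => α * √(d2 B y.2.1 y.2.2))
      (x0, x1, x2) := ((differentiableAt_d2 B (x0, x1, x2)).sqrt h2.ne').const_mul α
  exact e2.fun_mul ((differentiableAt_d1 B (x0, x1, x2)).fun_inv h1.ne')

lemma fderiv_Lc {B : Matrix (Fin d) (Fin d) ℝ} (hB : B.IsSymm) (α : ℝ) {x0 x1 x2 : V d}
    (h1 : 0 < d1 B x1) (h2 : 0 < d2 B x1 x2) (v1 v2 : V d) :
    fderiv ℝ (Lc B α) (x0, x1, x2) (0, v1, v2) =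
      α * ((bf B x1 v1 * bf B x2 x2 + bf B x1 x1 * bf B x2 v2
          - bf B x1 x2 * (bf B x2 v1 + bf B x1 v2)) / (√(d2 B x1 x2) * d1 B x1)
        - 2 * √(d2 B x1 x2) * bf B x1 v1 / d1 B x1 ^ 2) := by
  apply fderiv_apply_eq_of_hasDerivAt (differentiableAt_Lc α h1 h2)
  have hl := hasDerivAt_line x1 v1
  have hd1 : HasDerivAt (fun t : ℝ => d1 B (x1 + t • v1)) (2 * bf B x1 v1) 0 := by
    simp only [d1_eq]
    refine (hl.bf hl).congr_deriv ?_
    simp only [zero_smul, add_zero]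
    rw [bf_comm hB v1 x1]
    ring
  have h2' : d2 B (x1 + (0 : ℝ) • v1) (x2 + (0 : ℝ) • v2) ≠ 0 := by simpa using h2.ne'
  have h1' : d1 B (x1 + (0 : ℝ) • v1) ≠ 0 := by simpa using h1.ne'
  refine ((((hasDerivAt_d2_line hB x1 x2 v1 v2).sqrt h2').const_mul α).fun_div hd1
    h1').congr_deriv ?_
  simp only [zero_smul, add_zero]
  have hs := (Real.sqrt_pos.2 h2).ne'
  have h1n := h1.ne'
  field_simp

lemma bf_single {B : Matrix (Fin d) (Fin d) ℝ} (hB : B.IsSymm) (u : V d) (a : Fin d) :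
    bf B u (Pi.single a 1) = (B *ᵥ u) a := by
  rw [bf_comm hB, bf, single_one_dotProduct]

lemma inv_mulVec_bf {B : Matrix (Fin d) (Fin d) ℝ} (hB : B.IsSymm) (hdet : IsUnit B.det)
    (u : V d) : (B⁻¹ *ᵥ fun a => bf B u (Pi.single a 1)) = u := by
  simp only [bf_single hB]
  change B⁻¹ *ᵥ (B *ᵥ u) = u
  rw [Matrix.mulVec_mulVec, Matrix.nonsing_inv_mul _ hdet, Matrix.one_mulVec]

lemma p1h_eq {B : Matrix (Fin d) (Fin d) ℝ} (hB : B.IsSymm) (hdet : IsUnit B.det) (α : ℝ)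
    {x0 x1 x2 : V d} (h1 : 0 < d1 B x1) (h2 : 0 < d2 B x1 x2) :
    p1h B α x0 x1 x2 = (α / √(d2 B x1 x2)) • xi2 B x1 x2 := by
  rw [← inv_mulVec_bf hB hdet ((α / √(d2 B x1 x2)) • xi2 B x1 x2), p1h]
  congr 1
  funext a
  rw [fderiv_Lc hB α h1 h2]
  have hs := (Real.sqrt_pos.2 h2).ne'
  have hz (u : V d) : bf B u 0 = 0 := by simp [bf]
  rw [d1_eq] at h1 ⊢
  have h1n := h1.ne'
  simp only [xi2, bf_smul_left, bf_sub_left, hz, bf_comm hB x2 x1]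
  field_simp
  ring

/-- The total time derivative of `p̂¹`, paired with a fixed vector `v`. -/
lemma fderiv_bf_p1h {B : Matrix (Fin d) (Fin d) ℝ} (hB : B.IsSymm) (hdet : IsUnit B.det) (α : ℝ)
    {x0 x1 x2 : V d} (x3 v : V d) (h1 : 0 < d1 B x1) (h2 : 0 < d2 B x1 x2) :
    fderiv ℝ (fun y : V d × V d × V d => bf B (p1h B α y.1 y.2.1 y.2.2) v)
        (x0, x1, x2) (x1, x2, x3) =
      α / √(d2 B x1 x2) *
        (bf B x3 v - bf B x1 x2 / d1 B x1 * bf B x2 v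
          - ((bf B x2 x2 + bf B x1 x3) / d1 B x1 - 2 * bf B x1 x2 ^ 2 / d1 B x1 ^ 2) * bf B x1 v
          - (bf B x1 x1 * bf B x2 x3 - bf B x1 x2 * bf B x1 x3) / d2 B x1 x2 *
            (bf B x2 v - bf B x1 x2 / d1 B x1 * bf B x1 v)) := by
  have hev : (fun y : V d × V d × V d => bf B (p1h B α y.1 y.2.1 y.2.2) v) =ᶠ[nhds (x0, x1, x2)]
      fun y => α / √(d2 B y.2.1 y.2.2) *
        (bf B y.2.2 v - bf B y.2.1 y.2.2 / d1 B y.2.1 * bf B y.2.1 v) := by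
    filter_upwards [(differentiableAt_d1 B (x0, x1, x2)).continuousAt.eventually (lt_mem_nhds h1),
      (differentiableAt_d2 B (x0, x1, x2)).continuousAt.eventually (lt_mem_nhds h2)]
      with y hy1 hy2
    rw [p1h_eq hB hdet α hy1 hy2, d1_eq]
    simp only [xi2, bf_smul_left, bf_sub_left, bf_comm hB y.2.2 y.2.1]
  rw [hev.fderiv_eq]
  have hs := (Real.sqrt_pos.2 h2).ne'
  have h1n := h1.ne'
  apply fderiv_apply_eq_of_hasDerivAt
  · have e1 : DifferentiableAt ℝ (fun y : V d × V d × V d => y.2.1) (x0, x1, x2) := by fun_prop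
    have e2 : DifferentiableAt ℝ (fun y : V d × V d × V d => y.2.2) (x0, x1, x2) := by fun_prop
    have ev : DifferentiableAt ℝ (fun _ : V d × V d × V d => v) (x0, x1, x2) := by fun_prop
    have e3 : DifferentiableAt ℝ (fun y : V d × V d × V d => α / √(d2 B y.2.1 y.2.2))
        (x0, x1, x2) :=
      (((differentiableAt_d2 B (x0, x1, x2)).sqrt h2.ne').fun_inv hs).const_mul α
    have e4 : DifferentiableAt ℝ (fun y : V d × V d × V d => bf B y.2.1 y.2.2 / d1 B y.2.1)
        (x0, x1, x2) :=
      (e1.bf e2).fun_mul ((differentiableAt_d1 B (x0, x1, x2)).fun_inv h1n)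
    exact e3.fun_mul ((e2.bf ev).fun_sub (e4.fun_mul (e1.bf ev)))
  · have l1 := hasDerivAt_line x1 x2
    have l2 := hasDerivAt_line x2 x3
    have lv := hasDerivAt_const (0 : ℝ) v
    have hd1 : HasDerivAt (fun t : ℝ => d1 B (x1 + t • x2)) (2 * bf B x1 x2) 0 := by
      simp only [d1_eq]
      refine (l1.bf l1).congr_deriv ?_
      simp only [zero_smul, add_zero]
      rw [bf_comm hB x2 x1]
      ring
    have h2' : d2 B (x1 + (0 : ℝ) • x2) (x2 + (0 : ℝ) • x3) ≠ 0 := by simpa using h2.ne'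
    have hs' : √(d2 B (x1 + (0 : ℝ) • x2) (x2 + (0 : ℝ) • x3)) ≠ 0 := by simpa using hs
    have h1' : d1 B (x1 + (0 : ℝ) • x2) ≠ 0 := by simpa using h1n
    refine (((hasDerivAt_const (0 : ℝ) α).fun_div ((hasDerivAt_d2_line hB x1 x2 x2 x3).sqrt h2')
      hs').fun_mul ((l2.bf lv).fun_sub
        (((l1.bf l2).fun_div hd1 h1').fun_mul (l1.bf lv)))).congr_deriv ?_
    have hz (u : V d) : bf B u 0 = 0 := by simp [bf]
    simp only [zero_smul, add_zero, hz, Real.sq_sqrt h2.le]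
    have h2n := h2.ne'
    field_simp
    ring

lemma p0h_eq {B : Matrix (Fin d) (Fin d) ℝ} (hB : B.IsSymm) (hdet : IsUnit B.det) (α : ℝ)
    {x0 x1 x2 : V d} (x3 : V d) (h1 : 0 < d1 B x1) (h2 : 0 < d2 B x1 x2) :
    p0h B α x0 x1 x2 x3 = (α / (√(d2 B x1 x2) * d2 B x1 x2)) •
      ((bf B x1 x3 * bf B x2 x2 - bf B x1 x2 * bf B x2 x3) • x1
        + (bf B x1 x1 * bf B x2 x3 - bf B x1 x2 * bf B x1 x3) • x2
        - d2 B x1 x2 • x3) := by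
  rw [← inv_mulVec_bf hB hdet ((α / (√(d2 B x1 x2) * d2 B x1 x2)) • _), p0h]
  congr 1
  funext a
  rw [fderiv_Lc hB α h1 h2, fderiv_bf_p1h hB hdet α x3 _ h1 h2]
  have hs := (Real.sqrt_pos.2 h2).ne'
  have hsq := Real.sq_sqrt h2.le
  have hz (u : V d) : bf B u 0 = 0 := by simp [bf]
  have hd := d2_eq B x1 x2
  rw [bf_comm hB x2 x1] at hd
  have h1n := h1.ne'
  have h2n := h2.ne'
  generalize √(d2 B x1 x2) = s at *
  generalize d2 B x1 x2 = D at *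
  subst hsq
  rw [d1_eq] at h1n ⊢
  simp only [bf_smul_left, bf_sub_left, bf_add_left, hz]
  field_simp
  rw [hd]
  ring

/-- the momenta satisfy the Hamiltonian constraints.
For the curvature Lagrangian, identically on the set where `δ₁ > 0` and
`δ₂ > 0`: `(p̂¹ x₁) = 0`, `(p̂¹ p̂¹) = α²/(x₁ x₁)`, `(p̂⁰ x₁) = 0`,
`(p̂⁰ p̂¹) = 0` and `(p̂⁰ p̂⁰) = α² δ₃/δ₂²`. -/
theorem curvature_momenta_constraints
    (d : ℕ) (hd : 3 ≤ d) (B : Matrix (Fin d) (Fin d) ℝ)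
    (hBsymm : B.IsSymm) (hBnd : IsUnit B.det)
    (α : ℝ) (hα : α ≠ 0)
    (x0 x1 x2 x3 : V d) (h1 : 0 < d1 B x1) (h2 : 0 < d2 B x1 x2) :
    bf B (p1h B α x0 x1 x2) x1 = 0 ∧
    bf B (p1h B α x0 x1 x2) (p1h B α x0 x1 x2) = α^2 / bf B x1 x1 ∧
    bf B (p0h B α x0 x1 x2 x3) x1 = 0 ∧
    bf B (p0h B α x0 x1 x2 x3) (p1h B α x0 x1 x2) = 0 ∧
    bf B (p0h B α x0 x1 x2 x3) (p0h B α x0 x1 x2 x3) =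
      α^2 * d3 B x1 x2 x3 / (d2 B x1 x2)^2 := by
  have hs := (Real.sqrt_pos.2 h2).ne'
  have hsq := Real.sq_sqrt h2.le
  have hD := d2_eq B x1 x2
  rw [p1h_eq hBsymm hBnd α h1 h2, p0h_eq hBsymm hBnd α x3 h1 h2, d3_eq, xi2]
  rw [bf_comm hBsymm x2 x1] at hD ⊢
  rw [bf_comm hBsymm x3 x1, bf_comm hBsymm x3 x2]
  have h1n := h1.ne'
  have h2n := h2.ne'
  rw [d1_eq] at h1n
  generalize √(d2 B x1 x2) = s at *
  generalize d2 B x1 x2 = D at *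
  simp only [bf_smul_left, bf_sub_left, bf_add_left, bf_smul_right, bf_sub_right, bf_add_right,
    bf_comm hBsymm x2 x1, bf_comm hBsymm x3 x1, bf_comm hBsymm x3 x2]
  refine ⟨?_, ?_, ?_, ?_, ?_⟩
  · field_simp
    ring
  · field_simp
    rw [hsq, hD]
    ring
  · field_simp
    subst hD
    ring
  · field_simp
    subst hD
    ring
  · field_simp
    rw [hsq, hD]
    ring

end
end
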